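/- arXiv:2206.09947 — 2 statements merged into one kernel-verified Lean document; each statement's English description precedes it below -/
import Mathlib

section
/- If ξ, η are real numbers satisfying ξ ≤ 0, 4η²/π² − 2η + ξ² ≤ 0, and (4ξ/π² − 1)η² + (ξ² − 2ξ)η + ξ³ ≥ 0, then the operator norm of I + ξV + ηV² on L²[0,1] equals 1, where V is the Volterra operator. In particular, ‖I − V + V²‖ = 1. -/
open MeasureTheory Real

noncomputable def m : Measure ℝ := volume.restrict (Set.Icc 0 1)

open scoped ENNReal

instance instFin_m : IsFiniteMeasure m := by unfold m; infer_instance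
instance instNoAtoms_m : NullSingletonClass m := by unfold m; infer_instance

lemma m_univ : m Set.univ = 1 := by simp [m]

lemma int_Iic (f : ℝ → ℂ) (x : ℝ) :
    ∫ t in Set.Ioc 0 x, f t ∂m = ∫ t in Set.Iic x, f t ∂m := by
  apply setIntegral_congr_set
  have h : ∀ᵐ t ∂m, t ≠ 0 := by simp [ae_iff]
  have h' : ∀ᵐ t ∂m, t ∈ Set.Icc (0:ℝ) 1 := ae_restrict_mem measurableSet_Icc
  filter_upwards [h, h'] with t ht ht'
  have : 0 < t := lt_of_le_of_ne ht'.1 (Ne.symm ht)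
  apply propext
  change t ∈ Set.Ioc 0 x ↔ t ∈ Set.Iic x
  simp [this]

lemma integrable_Lp (f : Lp ℂ 2 m) : Integrable f m :=
  (Lp.memLp f).integrable (by norm_num)

noncomputable def e : Lp ℂ 2 m := Lp.const 2 m (1:ℂ)

lemma e_coe : (e : ℝ → ℂ) =ᵐ[m] fun _ => 1 := Lp.coeFn_const ..

lemma inner_e (f : Lp ℂ 2 m) : inner ℂ e f = ∫ t, f t ∂m := by
  rw [L2.inner_def]
  apply integral_congr_ae
  filter_upwards [e_coe] with t ht
  rw [ht]; simp

lemma norm_e : ‖e‖ = 1 := by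
  have h : ‖e‖ ^ 2 = 1 := by
    rw [norm_sq_eq_re_inner (𝕜 := ℂ), inner_e, integral_congr_ae e_coe]
    simp [m_univ, measureReal_def]
  nlinarith [norm_nonneg e]

lemma fubini_id (f g : Lp ℂ 2 m) (F G : ℝ → ℂ)
    (hF : F =ᵐ[m] fun x => ∫ t in Set.Iic x, f t ∂m)
    (hG : G =ᵐ[m] fun x => ∫ t in Set.Iic x, g t ∂m) :
    (∫ x, G x * star (f x) ∂m) + ∫ x, g x * star (F x) ∂m
      = (∫ x, star (f x) ∂m) * ∫ x, g x ∂m := by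
  have hf := integrable_Lp f
  have hg := integrable_Lp g
  have hfs : Integrable (fun x => star (f x)) m := by
    refine ⟨Complex.continuous_conj.comp_aestronglyMeasurable hf.1, ?_⟩
    refine hf.2.mono (Filter.Eventually.of_forall fun x => ?_)
    simp
  have hp : Integrable (fun p : ℝ × ℝ => star (f p.1) * g p.2) (m.prod m) := hfs.mul_prod hg
  have hS : MeasurableSet {p : ℝ × ℝ | p.2 ≤ p.1} := measurableSet_le measurable_snd measurable_fst
  have hT : MeasurableSet {p : ℝ × ℝ | p.1 ≤ p.2} := measurableSet_le measurable_fst measurable_snd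
  have e1 : (∫ x, G x * star (f x) ∂m)
      = ∫ p, Set.indicator {p : ℝ × ℝ | p.2 ≤ p.1} (fun p => star (f p.1) * g p.2) p ∂(m.prod m) := by
    rw [integral_prod _ (hp.indicator hS)]
    apply integral_congr_ae
    filter_upwards [hG] with x hx
    rw [hx, mul_comm, ← integral_const_mul, ← integral_indicator measurableSet_Iic]
    congr 1
  have e2 : (∫ x, g x * star (F x) ∂m)
      = ∫ p, Set.indicator {p : ℝ × ℝ | p.1 ≤ p.2} (fun p => star (f p.1) * g p.2) p ∂(m.prod m) := by
    rw [integral_prod_symm _ (hp.indicator hT)]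
    apply integral_congr_ae
    filter_upwards [hF] with x hx
    have : star (∫ t in Set.Iic x, f t ∂m) = ∫ t in Set.Iic x, star (f t) ∂m := by
      exact integral_conj.symm
    rw [hx, this, mul_comm, ← integral_mul_const, ← integral_indicator measurableSet_Iic]
    congr 1
  rw [e1, e2, ← integral_add (hp.indicator hS) (hp.indicator hT), ← integral_prod_mul (fun x => star (f x)) g]
  apply integral_congr_ae
  have hne : ∀ᵐ p ∂(m.prod m), p.1 ≠ p.2 := by
    rw [Measure.ae_prod_iff_ae_ae]
    · refine Filter.Eventually.of_forall fun x => ?_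
      simp [ae_iff]
    · exact (measurableSet_eq_fun measurable_fst measurable_snd).compl
  filter_upwards [hne] with p hp
  rcases lt_or_gt_of_ne hp with h | h
  · simp [Set.indicator, h.le, not_le.2 h]
  · simp [Set.indicator, h.le, not_le.2 h]

lemma V_adj (V : Lp ℂ 2 m →L[ℂ] Lp ℂ 2 m)
    (hV : ∀ f : Lp ℂ 2 m, V f =ᵐ[m] fun x => ∫ t in Set.Ioc 0 x, f t ∂m) (f g : Lp ℂ 2 m) :
    inner ℂ f (V g) + inner ℂ (V f) g = inner ℂ f e * inner ℂ e g := by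
  have h := fubini_id f g (V f) (V g) (by simpa only [int_Iic] using hV f)
    (by simpa only [int_Iic] using hV g)
  rw [← inner_conj_symm f e, inner_e, inner_e, L2.inner_def, L2.inner_def]
  rw [← integral_conj]
  exact h

lemma V_not_surj (V : Lp ℂ 2 m →L[ℂ] Lp ℂ 2 m)
    (hV : ∀ f : Lp ℂ 2 m, V f =ᵐ[m] fun x => ∫ t in Set.Ioc 0 x, f t ∂m) (f : Lp ℂ 2 m) :
    V f ≠ e := by
  intro h
  have h1 : ∀ᵐ x ∂m, (∫ t in (0:ℝ)..x, f t ∂m) = 1 := by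
    have h' : ∀ᵐ t ∂m, t ∈ Set.Icc (0:ℝ) 1 := ae_restrict_mem measurableSet_Icc
    filter_upwards [hV f, e_coe, h'] with x hx he hx'
    rw [intervalIntegral.integral_of_le hx'.1, ← hx, h, he]
  have hc : Continuous fun x => (∫ t in (0:ℝ)..x, f t ∂m) :=
    intervalIntegral.continuous_primitive (fun a b => (integrable_Lp f).intervalIntegrable) 0
  have h2 := Measure.eqOn_Icc_of_ae_eq (μ := volume) (zero_ne_one (α := ℝ)) h1 hc.continuousOn continuousOn_const
  have := h2 (Set.left_mem_Icc.2 zero_le_one)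
  simp at this

lemma main_abs (V : Lp ℂ 2 m →L[ℂ] Lp ℂ 2 m)
    (hA : ∀ f g, inner ℂ f (V g) + inner ℂ (V f) g = inner ℂ f e * inner ℂ e g)
    (hB : ∀ g, ‖V g‖ ^ 2 ≤ 4 / π ^ 2 * ‖g‖ ^ 2) (ξ η : ℝ)
    (h1 : ξ < 0)
    (h2 : 4 * η ^ 2 / π ^ 2 - 2 * η + ξ ^ 2 ≤ 0)
    (h3 : 0 ≤ (4 * ξ / π ^ 2 - 1) * η ^ 2 + (ξ ^ 2 - 2 * ξ) * η + ξ ^ 3) (f : Lp ℂ 2 m) :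
    ‖f + (ξ : ℂ) • V f + (η : ℂ) • V (V f)‖ ^ 2 ≤ ‖f‖ ^ 2 := by
  set g := V f with hg
  set h := V g with hh
  have hfg := congrArg Complex.re (hA f f)
  have hfh := congrArg Complex.re (hA f g)
  have hgh := congrArg Complex.re (hA g g)
  have hgg : RCLike.re (inner ℂ g g) = ‖g‖ ^ 2 := (norm_sq_eq_re_inner g).symm
  have hCS : ‖inner ℂ e g‖ ^ 2 ≤ ‖g‖ ^ 2 := by
    have := norm_inner_le_norm (𝕜 := ℂ) e g
    rw [norm_e, one_mul] at this
    gcongr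
  have hP := hB g
  have key : ‖f + (ξ : ℂ) • g + (η : ℂ) • h‖ ^ 2 = ‖f‖ ^ 2 + ξ ^ 2 * ‖g‖ ^ 2 + η ^ 2 * ‖h‖ ^ 2
      + 2 * ξ * (inner ℂ f g).re + 2 * η * (inner ℂ f h).re + 2 * ξ * η * (inner ℂ g h).re := by
    rw [norm_add_sq (𝕜 := ℂ), norm_add_sq (𝕜 := ℂ)]
    simp only [inner_add_left, inner_smul_left, inner_smul_right, norm_smul, map_add, mul_pow]
    simp
    ring
  rw [key]
  rw [← hg, ← hh] at *
  rw [← inner_conj_symm f e] at hfg hfh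
  rw [← inner_conj_symm g e] at hgh
  rw [← inner_conj_symm g f] at hfg
  rw [← inner_conj_symm h g] at hgh
  rw [Complex.sq_norm, Complex.normSq_apply] at hCS
  simp only [Complex.add_re, Complex.mul_re, Complex.conj_re, Complex.conj_im] at hfg hfh hgh
  simp only [RCLike.re_to_complex] at hgg
  rw [hgg] at hfh
  generalize (inner ℂ e f).re = a1 at *
  generalize (inner ℂ e f).im = a2 at *
  generalize (inner ℂ e g).re = b1 at *
  generalize (inner ℂ e g).im = b2 at *
  generalize (inner ℂ f g).re = p1 at *
  generalize (inner ℂ f h).re = p2 at *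
  generalize (inner ℂ g h).re = p3 at *
  generalize ‖g‖ ^ 2 = G at *
  generalize ‖h‖ ^ 2 = H at *
  clear key hgg hA hB
  have hp1 : p1 = (a1 ^ 2 + a2 ^ 2) / 2 := by linarith
  have hp2 : p2 = a1 * b1 + a2 * b2 - G := by linarith
  have hp3 : p3 = (b1 ^ 2 + b2 ^ 2) / 2 := by linarith
  have hk1 : 4 * η ^ 2 / π ^ 2 = 4 / π ^ 2 * η ^ 2 := by ring
  have hk2 : 4 * ξ / π ^ 2 = 4 / π ^ 2 * ξ := by ring
  rw [hk1] at h2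
  rw [hk2] at h3
  generalize 4 / π ^ 2 = k at *
  have hB0 : 0 ≤ b1 * b1 + b2 * b2 := add_nonneg (mul_self_nonneg _) (mul_self_nonneg _)
  have hG0 : 0 ≤ G := hB0.trans hCS
  subst hp1 hp2 hp3
  suffices hs : 0 ≤ ξ * (ξ ^ 2 * G + η ^ 2 * H + ξ * (a1 ^ 2 + a2 ^ 2) +
      2 * η * (a1 * b1 + a2 * b2 - G) + ξ * η * (b1 ^ 2 + b2 ^ 2)) by
    have := nonpos_of_mul_nonneg_right hs h1
    linarith
  have q1 : ξ * (η ^ 2 * (k * G)) ≤ ξ * (η ^ 2 * H) :=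
    mul_le_mul_of_nonpos_left (mul_le_mul_of_nonneg_left hP (sq_nonneg _)) h1.le
  have q2 : 0 ≤ (ξ * a1 + η * b1) ^ 2 + (ξ * a2 + η * b2) ^ 2 := by positivity
  suffices q3 : 0 ≤ ξ * (ξ ^ 2 - 2 * η + k * η ^ 2) * G - (η ^ 2 - ξ ^ 2 * η) * (b1 * b1 + b2 * b2) by
    nlinarith
  rcases le_total (η ^ 2 - ξ ^ 2 * η) 0 with hc | hc
  · have r1 : 0 ≤ ξ * (ξ ^ 2 - 2 * η + k * η ^ 2) * G :=
      mul_nonneg (mul_nonneg_of_nonpos_of_nonpos h1.le (by linarith)) hG0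
    have r2 := mul_nonneg (neg_nonneg.2 hc) hB0
    linarith
  · have r1 := mul_le_mul_of_nonneg_left hCS hc
    have r2 := mul_nonneg h3 hG0
    nlinarith

lemma enorm_sq_L2 (f : Lp ℂ 2 m) : ‖f‖ₑ ^ 2 = ∫⁻ x, ‖f x‖ₑ ^ 2 ∂m := by
  rw [Lp.enorm_def, eLpNorm_eq_lintegral_rpow_enorm_toReal (by norm_num) (by norm_num)]
  rw [← ENNReal.rpow_natCast, ← ENNReal.rpow_mul]
  simp

noncomputable def w (t : ℝ) : ℝ≥0∞ := ENNReal.ofReal (cos (π / 2 * t))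

lemma w_meas : Measurable w := by unfold w; fun_prop

lemma int_w {x : ℝ} (hx : x ∈ Set.Icc (0:ℝ) 1) :
    ∫⁻ t in Set.Iic x, w t ∂m = ENNReal.ofReal (2 / π * sin (π / 2 * x)) := by
  have hr : m.restrict (Set.Iic x) = volume.restrict (Set.Icc 0 x) := by
    rw [m, Measure.restrict_restrict measurableSet_Iic]
    congr 1
    ext t; simp only [Set.mem_inter_iff, Set.mem_Iic, Set.mem_Icc]
    constructor
    · rintro ⟨a, b, c⟩; exact ⟨b, a⟩
    · rintro ⟨a, b⟩; exact ⟨b, a, b.trans hx.2⟩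
  rw [hr]
  unfold w
  rw [← ofReal_integral_eq_lintegral_ofReal]
  · rw [integral_Icc_eq_integral_Ioc, ← intervalIntegral.integral_of_le hx.1,
      intervalIntegral.integral_comp_mul_left (fun u => cos u) (by positivity)]
    simp
  · exact (Continuous.continuousOn (by fun_prop)).integrableOn_compact isCompact_Icc
  · refine (ae_restrict_iff' measurableSet_Icc).2 (Filter.Eventually.of_forall fun t ht => ?_)
    apply cos_nonneg_of_mem_Icc
    have := pi_pos
    constructor <;> nlinarith [ht.1, ht.2, hx.2]

lemma int_s {x : ℝ} (hx : x ∈ Set.Icc (0:ℝ) 1) :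
    ∫⁻ t in Set.Ici x, ENNReal.ofReal (2 / π * sin (π / 2 * t)) ∂m = ENNReal.ofReal (4 / π ^ 2) * w x := by
  have hr : m.restrict (Set.Ici x) = volume.restrict (Set.Icc x 1) := by
    rw [m, Measure.restrict_restrict measurableSet_Ici]
    congr 1
    ext t; simp only [Set.mem_inter_iff, Set.mem_Ici, Set.mem_Icc]
    constructor
    · rintro ⟨a, b, c⟩; exact ⟨a, c⟩
    · rintro ⟨a, b⟩; exact ⟨a, hx.1.trans a, b⟩
  rw [hr]
  unfold w
  rw [← ofReal_integral_eq_lintegral_ofReal, ← ENNReal.ofReal_mul (by positivity)]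
  · rw [integral_Icc_eq_integral_Ioc, ← intervalIntegral.integral_of_le hx.2,
      intervalIntegral.integral_const_mul,
      intervalIntegral.integral_comp_mul_left (fun u => sin u) (by positivity)]
    simp
    ring_nf
  · exact (Continuous.continuousOn (by fun_prop)).integrableOn_compact isCompact_Icc
  · refine (ae_restrict_iff' measurableSet_Icc).2 (Filter.Eventually.of_forall fun t ht => ?_)
    have := pi_pos
    refine mul_nonneg (by positivity) (sin_nonneg_of_mem_Icc ?_)
    constructor <;> nlinarith [ht.1, ht.2, hx.1]

lemma w_pos : ∀ᵐ t ∂m, w t ≠ 0 := by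
  have h : ∀ᵐ t ∂m, t ≠ 1 := by simp [ae_iff]
  have h' : ∀ᵐ t ∂m, t ∈ Set.Icc (0:ℝ) 1 := ae_restrict_mem measurableSet_Icc
  filter_upwards [h, h'] with t ht ht'
  have : t < 1 := lt_of_le_of_ne ht'.2 ht
  have hp := pi_pos
  have : 0 < cos (π / 2 * t) := by
    apply cos_pos_of_mem_Ioo
    constructor <;> nlinarith [ht'.1]
  simpa [w] using this

lemma w_top (t : ℝ) : w t ≠ ⊤ := ENNReal.ofReal_ne_top

lemma V_bound (V : Lp ℂ 2 m →L[ℂ] Lp ℂ 2 m)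
    (hV : ∀ f : Lp ℂ 2 m, V f =ᵐ[m] fun x => ∫ t in Set.Ioc 0 x, f t ∂m) (g : Lp ℂ 2 m) :
    ‖V g‖ ^ 2 ≤ 4 / π ^ 2 * ‖g‖ ^ 2 := by
  have hm : AEMeasurable (fun t => ‖g t‖ₑ ^ 2 / w t) m :=
    ((Lp.aestronglyMeasurable g).enorm.pow_const 2).div w_meas.aemeasurable
  have h' : ∀ᵐ t ∂m, t ∈ Set.Icc (0:ℝ) 1 := ae_restrict_mem measurableSet_Icc
  have pt : ∀ᵐ x ∂m, ‖V g x‖ₑ ^ 2 ≤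
      ∫⁻ t, (Set.Iic x).indicator (fun t => ‖g t‖ₑ ^ 2 / w t * ENNReal.ofReal (2 / π * sin (π / 2 * x))) t ∂m := by
    filter_upwards [hV g, h'] with x hx hx'
    rw [hx, int_Iic, lintegral_indicator measurableSet_Iic, lintegral_mul_const' _ _ ENNReal.ofReal_ne_top, ← int_w hx']
    have c1 : ‖∫ t in Set.Iic x, g t ∂m‖ₑ ≤ ∫⁻ t in Set.Iic x, ‖g t‖ₑ ∂m := enorm_integral_le_lintegral_enorm _
    have c2 : ∫⁻ t in Set.Iic x, ‖g t‖ₑ ∂m = ∫⁻ t in Set.Iic x, (‖g t‖ₑ ^ 2 / w t) ^ (1/2:ℝ) * (w t) ^ (1/2:ℝ) ∂m := by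
      apply lintegral_congr_ae
      filter_upwards [ae_restrict_of_ae w_pos] with t ht
      rw [← ENNReal.mul_rpow_of_nonneg _ _ (by norm_num), ENNReal.div_mul_cancel ht (w_top t),
        ← ENNReal.rpow_natCast, ← ENNReal.rpow_mul]
      simp
    have c3 := ENNReal.lintegral_mul_norm_pow_le (hm.restrict (s := Set.Iic x)) (w_meas.aemeasurable (μ := m.restrict (Set.Iic x)))
      (p := 1/2) (q := 1/2) (by norm_num) (by norm_num) (by norm_num)
    rw [← c2] at c3
    calc _ ≤ _ := pow_le_pow_left₀ (zero_le) (c1.trans c3) 2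
      _ = _ := by
        rw [mul_pow, ← ENNReal.rpow_natCast, ← ENNReal.rpow_natCast, ← ENNReal.rpow_mul, ← ENNReal.rpow_mul]
        simp
  have main : ‖V g‖ₑ ^ 2 ≤ ENNReal.ofReal (4 / π ^ 2) * ‖g‖ₑ ^ 2 := by
    rw [enorm_sq_L2, enorm_sq_L2]
    refine (lintegral_mono_ae pt).trans ?_
    rw [lintegral_lintegral_swap]
    · rw [← lintegral_const_mul' _ _ ENNReal.ofReal_ne_top]
      apply le_of_eq
      apply lintegral_congr_ae
      filter_upwards [w_pos, h'] with t ht ht'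
      have : ∀ x, (Set.Iic x).indicator (fun t => ‖g t‖ₑ ^ 2 / w t * ENNReal.ofReal (2 / π * sin (π / 2 * x))) t
        = (Set.Ici t).indicator (fun x => ‖g t‖ₑ ^ 2 / w t * ENNReal.ofReal (2 / π * sin (π / 2 * x))) x := by
        intro x; simp [Set.indicator]
      simp_rw [this]
      rw [lintegral_indicator measurableSet_Ici, lintegral_const_mul _ (by fun_prop), int_s ht',
        mul_left_comm, ENNReal.div_mul_cancel ht (w_top t)]
    · have hS : MeasurableSet {p : ℝ × ℝ | p.2 ≤ p.1} := measurableSet_le measurable_snd measurable_fst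
      have hq : AEMeasurable (fun p : ℝ × ℝ => ‖g p.2‖ₑ ^ 2 / w p.2 * ENNReal.ofReal (2 / π * sin (π / 2 * p.1))) (m.prod m) := by
        refine AEMeasurable.mul ?_ (by fun_prop)
        exact hm.comp_quasiMeasurePreserving Measure.quasiMeasurePreserving_snd
      exact hq.indicator hS
  have hfin := ENNReal.toReal_mono (by finiteness) main
  simpa [ENNReal.toReal_mul, ENNReal.toReal_ofReal (show 0 ≤ 4 / π ^ 2 by positivity)] using hfin

theorem norm_one_add_xi_V_add_eta_V_sq_eq_one (V : Lp ℂ 2 m →L[ℂ] Lp ℂ 2 m)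
    (hV : ∀ f : Lp ℂ 2 m, V f =ᵐ[m] fun x => ∫ t in Set.Ioc 0 x, f t ∂m)
    (ξ η : ℝ)
    (h1 : ξ ≤ 0)
    (h2 : 4 * η ^ 2 / π ^ 2 - 2 * η + ξ ^ 2 ≤ 0)
    (h3 : 0 ≤ (4 * ξ / π ^ 2 - 1) * η ^ 2 + (ξ ^ 2 - 2 * ξ) * η + ξ ^ 3) :
    ‖(1 : Lp ℂ 2 m →L[ℂ] Lp ℂ 2 m) + (ξ : ℂ) • V + (η : ℂ) • (V.comp V)‖ = 1 := by
  apply le_antisymm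
  · refine ContinuousLinearMap.opNorm_le_bound _ zero_le_one fun f => ?_
    rw [one_mul]
    rcases h1.lt_or_eq with h1 | h1
    · refine le_of_sq_le_sq ?_ (norm_nonneg _)
      exact main_abs V (V_adj V hV) (V_bound V hV) ξ η h1 h2 h3 f
    · subst h1
      have : η = 0 := by
        have : η ^ 2 ≤ 0 := by simp at h3; nlinarith
        exact pow_eq_zero_iff (two_ne_zero) |>.1 (le_antisymm this (sq_nonneg _))
      subst this
      simp
  · by_contra hlt
    push Not at hlt
    set W : Lp ℂ 2 m →L[ℂ] Lp ℂ 2 m := (ξ : ℂ) • V + (η : ℂ) • (V.comp V) with hW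
    rw [add_assoc, ← hW] at hlt
    have hu : IsUnit (1 - (1 + W)) := (Units.oneSub _ hlt).isUnit
    obtain ⟨u, hu⟩ := hu
    have h5 : (1 - (1 + W)) * (↑u⁻¹ : Lp ℂ 2 m →L[ℂ] Lp ℂ 2 m) = 1 := by rw [← hu]; simp
    have h6 := congrArg (fun T : Lp ℂ 2 m →L[ℂ] Lp ℂ 2 m => T e) h5
    set y := (↑u⁻¹ : Lp ℂ 2 m →L[ℂ] Lp ℂ 2 m) e with hy
    apply V_not_surj V hV (-((ξ : ℂ) • y + (η : ℂ) • V y))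
    have h7 : - W y = e := by
      simpa using h6
    rw [← h7, hW]
    rw [map_neg, map_add, map_smul, map_smul]
    rfl
end

section
/- For every β ∈ ℝ, the operator norm of V + iβI on L²[0,1], where V is the Volterra operator, equals 1/π + sqrt(β² + 1/π²). -/
open MeasureTheory Real
instance m_fin : IsFiniteMeasure m := by unfold m; infer_instance

lemma m_integral {E : Type*} [NormedAddCommGroup E] [NormedSpace ℝ E] (g : ℝ → E) :
    ∫ x, g x ∂m = ∫ x in (0:ℝ)..1, g x := by
  rw [intervalIntegral.integral_of_le zero_le_one, m, integral_Icc_eq_integral_Ioc]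

lemma m_inner_integral (f g : ℝ → ℂ) (h : f =ᵐ[m] g) {x : ℝ} (hx : x ∈ Set.Icc (0:ℝ) 1) :
    ∫ t in Set.Ioc 0 x, f t ∂m = ∫ t in (0:ℝ)..x, g t := by
  rw [integral_congr_ae (ae_restrict_of_ae h), intervalIntegral.integral_of_le hx.1, m,
    Measure.restrict_restrict measurableSet_Ioc]
  congr 2
  ext t
  simp only [Set.mem_inter_iff, Set.mem_Ioc, Set.mem_Icc]
  constructor
  · tauto
  · rintro ⟨h1, h2⟩; exact ⟨⟨h1, h2⟩, h1.le, h2.trans hx.2⟩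

lemma norm_sq_lp (u : Lp ℂ 2 m) (g : ℝ → ℂ) (h : u =ᵐ[m] g) :
    ‖u‖ ^ 2 = ∫ x in (0:ℝ)..1, ‖g x‖ ^ 2 := by
  rw [← m_integral]
  have h1 : (‖u‖ ^ 2 : ℝ) = RCLike.re (inner ℂ u u) := norm_sq_eq_re_inner (𝕜 := ℂ) u
  rw [h1, L2.inner_def, ← integral_re (L2.integrable_inner u u)]
  apply integral_congr_ae
  filter_upwards [h] with x hx
  rw [← hx]
  exact (norm_sq_eq_re_inner (𝕜 := ℂ) (u x)).symm

lemma key_norm (V : Lp ℂ 2 m →L[ℂ] Lp ℂ 2 m)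
    (hV : ∀ f : Lp ℂ 2 m, V f =ᵐ[m] fun x => ∫ t in Set.Ioc 0 x, f t ∂m) (β : ℝ)
    (u : Lp ℂ 2 m) (g : ℝ → ℂ) (h : u =ᵐ[m] g) :
    ‖(V + ((β : ℂ) * Complex.I) • (1 : Lp ℂ 2 m →L[ℂ] Lp ℂ 2 m)) u‖ ^ 2 =
      ∫ x in (0:ℝ)..1, ‖(∫ t in (0:ℝ)..x, g t) + β * Complex.I * g x‖ ^ 2 := by
  apply norm_sq_lp
  have e : (V + ((β : ℂ) * Complex.I) • (1 : Lp ℂ 2 m →L[ℂ] Lp ℂ 2 m)) u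
      = V u + ((β : ℂ) * Complex.I) • u := by simp
  rw [e]
  have hm : ∀ᵐ x ∂m, x ∈ Set.Icc (0:ℝ) 1 := ae_restrict_mem measurableSet_Icc
  filter_upwards [h, hV u, hm, Lp.coeFn_add (V u) (((β : ℂ) * Complex.I) • u),
    Lp.coeFn_smul ((β : ℂ) * Complex.I) u] with x h1 h2 h3 h4 h5
  rw [h4, Pi.add_apply, h5, Pi.smul_apply, h2, h1, m_inner_integral u g h h3, smul_eq_mul]

/-- Weighted inequality for continuous functions, before the limit in `ω`. -/
lemma ineq_omega (g : ℝ → ℂ) (hg : Continuous g) (β l μ ω : ℝ) (hμ : 0 < μ)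
    (h1 : l ^ 2 = β ^ 2 + μ) (h2 : l ^ 2 = μ ^ 2 * (π ^ 2 / 4)) (hω0 : 0 < ω)
    (hω : ω < π / 2) :
    ∫ x in (0:ℝ)..1, ‖(∫ t in (0:ℝ)..x, g t) + β * Complex.I * g x‖ ^ 2 ≤
      l ^ 2 * (∫ x in (0:ℝ)..1, ‖g x‖ ^ 2) +
        μ * (π ^ 2 / 4 - ω ^ 2) * ∫ x in (0:ℝ)..1, ‖∫ t in (0:ℝ)..x, g t‖ ^ 2 := by
  set F : ℝ → ℂ := fun x => ∫ t in (0:ℝ)..x, g t with hF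
  have hFd : ∀ x, HasDerivAt F (g x) x := fun x =>
    intervalIntegral.integral_hasDerivAt_right (hg.intervalIntegrable _ _)
      hg.aestronglyMeasurable.stronglyMeasurableAtFilter hg.continuousAt
  have hFc : Continuous F := continuous_iff_continuousAt.2 fun x => (hFd x).continuousAt
  have hre : ∀ x, HasDerivAt (fun x => (F x).re) (g x).re x := fun x =>
    (Complex.reCLM.hasFDerivAt.comp_hasDerivAt x (hFd x))
  have him : ∀ x, HasDerivAt (fun x => (F x).im) (g x).im x := fun x =>
    (Complex.imCLM.hasFDerivAt.comp_hasDerivAt x (hFd x))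
  have hcos : ∀ x ∈ Set.uIcc (0:ℝ) 1, cos (ω * (1 - x)) ≠ 0 := by
    intro x hx
    rw [Set.uIcc_of_le zero_le_one] at hx
    apply ne_of_gt
    apply cos_pos_of_mem_Ioo
    constructor <;> nlinarith [hx.1, hx.2, pi_pos]
  set w : ℝ → ℝ := fun x => ω * tan (ω * (1 - x)) with hw
  have hwd : ∀ x ∈ Set.uIcc (0:ℝ) 1, HasDerivAt w (-(ω ^ 2 + w x ^ 2)) x := by
    intro x hx
    have hc := hcos x hx
    have a : HasDerivAt (fun x : ℝ => ω * (1 - x)) (ω * (-1)) x :=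
      ((hasDerivAt_id x).const_sub 1).const_mul ω
    have b := ((Real.hasDerivAt_tan hc).comp x a).const_mul ω
    refine HasDerivAt.congr_deriv (f := w) b ?_
    simp only [hw]
    rw [tan_eq_sin_div_cos]
    field_simp
    linear_combination sin_sq_add_cos_sq (ω * (1 - x))
  have hwc : ContinuousOn w (Set.uIcc (0:ℝ) 1) := fun x hx =>
    (hwd x hx).continuousAt.continuousWithinAt
  set D : ℝ → ℝ := fun x => -(ω ^ 2 + w x ^ 2) * ((F x).re ^ 2 + (F x).im ^ 2) +
    w x * (2 * (F x).re * (g x).re + 2 * (F x).im * (g x).im) with hD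
  have hDd : ∀ x ∈ Set.uIcc (0:ℝ) 1,
      HasDerivAt (fun x => w x * ((F x).re ^ 2 + (F x).im ^ 2)) (D x) x := by
    intro x hx
    have := (hwd x hx).mul (((hre x).pow 2).add ((him x).pow 2))
    refine HasDerivAt.congr_deriv this ?_
    simp [hD]
  have hDc : ContinuousOn D (Set.uIcc (0:ℝ) 1) := by
    have := Complex.continuous_re.comp hFc
    have := Complex.continuous_im.comp hFc
    have := Complex.continuous_re.comp hg
    have := Complex.continuous_im.comp hg
    simp only [hD]
    fun_prop
  have hDi : IntervalIntegrable D volume 0 1 := hDc.intervalIntegrable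
  have hDzero : ∫ x in (0:ℝ)..1, D x = 0 := by
    rw [intervalIntegral.integral_eq_sub_of_hasDerivAt hDd hDi]
    simp [hw, hF]
  have i1 : IntervalIntegrable (fun x => ‖F x + β * Complex.I * g x‖ ^ 2) volume 0 1 :=
    Continuous.intervalIntegrable (by fun_prop) _ _
  have i2 : IntervalIntegrable (fun x => ‖g x‖ ^ 2) volume 0 1 :=
    Continuous.intervalIntegrable (by fun_prop) _ _
  have i3 : IntervalIntegrable (fun x => ‖F x‖ ^ 2) volume 0 1 :=
    Continuous.intervalIntegrable (by fun_prop) _ _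
  have hpt : ∀ x ∈ Set.Icc (0:ℝ) 1, ‖F x + β * Complex.I * g x‖ ^ 2 + μ * D x ≤
      l ^ 2 * ‖g x‖ ^ 2 + μ * (π ^ 2 / 4 - ω ^ 2) * ‖F x‖ ^ 2 := by
    intro x _
    simp only [← Complex.normSq_eq_norm_sq, Complex.normSq_apply, hD]
    simp only [Complex.add_re, Complex.add_im, Complex.mul_re, Complex.mul_im, Complex.I_re,
      Complex.I_im, Complex.ofReal_re, Complex.ofReal_im]
    generalize (F x).re = a
    generalize (F x).im = b
    generalize (g x).re = c
    generalize (g x).im = d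
    generalize w x = v
    have h3 : μ * (π ^ 2 / 4) = 1 + β ^ 2 / μ := by
      field_simp
      linear_combination 4 * h1 - 4 * h2
    have h4 : μ * (π ^ 2 / 4 - ω ^ 2) = 1 + β ^ 2 / μ - μ * ω ^ 2 := by linarith
    rw [h4, h1]
    have key : 0 ≤ μ * ((c - β / μ * b - v * a) ^ 2 + (d + β / μ * a - v * b) ^ 2) := by positivity
    have e : μ * ((c - β / μ * b - v * a) ^ 2 + (d + β / μ * a - v * b) ^ 2) =
      μ * ((c - v * a) ^ 2 + (d - v * b) ^ 2) + β ^ 2 / μ * (a ^ 2 + b ^ 2)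
        + 2 * β * (a * d - b * c) := by
      field_simp
      ring
    rw [e] at key
    linarith
  have := intervalIntegral.integral_mono_on zero_le_one (i1.add (hDi.const_mul μ))
    ((i2.const_mul (l ^ 2)).add (i3.const_mul (μ * (π ^ 2 / 4 - ω ^ 2)))) hpt
  rw [intervalIntegral.integral_add i1 (hDi.const_mul μ),
    intervalIntegral.integral_add (i2.const_mul _) (i3.const_mul _),
    intervalIntegral.integral_const_mul, intervalIntegral.integral_const_mul,
    intervalIntegral.integral_const_mul, hDzero] at this
  linarith

lemma ineq_cont (g : ℝ → ℂ) (hg : Continuous g) (β l μ : ℝ) (hμ : 0 < μ)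
    (h1 : l ^ 2 = β ^ 2 + μ) (h2 : l ^ 2 = μ ^ 2 * (π ^ 2 / 4)) :
    ∫ x in (0:ℝ)..1, ‖(∫ t in (0:ℝ)..x, g t) + β * Complex.I * g x‖ ^ 2 ≤
      l ^ 2 * (∫ x in (0:ℝ)..1, ‖g x‖ ^ 2) := by
  set A := ∫ x in (0:ℝ)..1, ‖g x‖ ^ 2
  set B := ∫ x in (0:ℝ)..1, ‖∫ t in (0:ℝ)..x, g t‖ ^ 2 with hB
  have hc : Continuous fun ω : ℝ => l ^ 2 * A + μ * (π ^ 2 / 4 - ω ^ 2) * B := by fun_prop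
  have ht := (hc.tendsto (π / 2)).mono_left (nhdsWithin_le_nhds (s := Set.Iio (π / 2)))
  have e : l ^ 2 * A + μ * (π ^ 2 / 4 - (π / 2) ^ 2) * B = l ^ 2 * A := by ring
  rw [e] at ht
  refine ge_of_tendsto ht ?_
  filter_upwards [Ioo_mem_nhdsLT (half_pos pi_pos)] with ω hω
  exact ineq_omega g hg β l μ ω hμ h1 h2 hω.1 hω.2

/-- The extremal function attains equality. -/
lemma extremal (β l μ : ℝ) (hμ : 0 < μ)
    (h1 : l ^ 2 = β ^ 2 + μ) (h2 : l ^ 2 = μ ^ 2 * (π ^ 2 / 4)) :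
    ∃ g : ℝ → ℂ, Continuous g ∧ 0 < (∫ x in (0:ℝ)..1, ‖g x‖ ^ 2) ∧
    ∫ x in (0:ℝ)..1, ‖(∫ t in (0:ℝ)..x, g t) + β * Complex.I * g x‖ ^ 2 =
      l ^ 2 * (∫ x in (0:ℝ)..1, ‖g x‖ ^ 2) := by
  set a : ℝ := β / μ with ha
  set G : ℝ → ℂ := fun x => Complex.exp (x * (-(a * Complex.I))) with hG
  set F : ℝ → ℂ := fun x => G x * ((sin (x * (π / 2)) : ℝ) : ℂ) with hF
  set g : ℝ → ℂ := fun x => G x * (((cos (x * (π / 2)) * (π / 2) : ℝ) : ℂ)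
    - a * Complex.I * ((sin (x * (π / 2)) : ℝ) : ℂ)) with hgdef
  have hGd : ∀ x, HasDerivAt G (G x * (-(a * Complex.I))) x := by
    intro x
    have q : HasDerivAt (fun x : ℝ => (x : ℂ) * (-(a * Complex.I))) (1 * (-(a * Complex.I))) x :=
      (Complex.ofRealCLM.hasDerivAt (x := x)).mul_const _
    convert q.cexp using 1
    simp [hG]
  have hFd : ∀ x, HasDerivAt F (g x) x := by
    intro x
    have q : HasDerivAt (fun x : ℝ => x * (π / 2)) (1 * (π / 2)) x :=
      (hasDerivAt_id x).mul_const _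
    have := (hGd x).mul (q.sin.ofReal_comp)
    refine HasDerivAt.congr_deriv (f := F) this ?_
    simp only [hgdef]
    push_cast
    ring
  have hGc : Continuous G := continuous_iff_continuousAt.2 fun x => (hGd x).continuousAt
  have hFc : Continuous F := continuous_iff_continuousAt.2 fun x => (hFd x).continuousAt
  have hgc : Continuous g := by
    simp only [hgdef]
    fun_prop
  have hGn : ∀ x, ‖G x‖ = 1 := by
    intro x
    simp only [hG]
    rw [show (x : ℂ) * (-(a * Complex.I)) = ((-(x * a) : ℝ) : ℂ) * Complex.I by push_cast; ring]
    exact Complex.norm_exp_ofReal_mul_I _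
  have hFi : ∀ x, ∫ t in (0:ℝ)..x, g t = F x := by
    intro x
    rw [intervalIntegral.integral_eq_sub_of_hasDerivAt (fun x _ => hFd x)
      (hgc.intervalIntegrable _ _)]
    simp [hF]
  have hgn : ∀ x, ‖g x‖ ^ 2 = (cos (x * (π / 2)) * (π / 2)) ^ 2 + (a * sin (x * (π / 2))) ^ 2 := by
    intro x
    simp only [hgdef]
    rw [norm_mul, hGn, one_mul, ← Complex.normSq_eq_norm_sq, Complex.normSq_apply]
    simp only [Complex.sub_re, Complex.sub_im, Complex.mul_re, Complex.mul_im, Complex.I_re,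
      Complex.I_im, Complex.ofReal_re, Complex.ofReal_im]
    ring
  refine ⟨g, hgc, ?_, ?_⟩
  · apply intervalIntegral.integral_pos zero_lt_one (by fun_prop) (fun x _ => by positivity)
    refine ⟨0, by simp, ?_⟩
    rw [hgn]
    simp only [zero_mul, cos_zero, sin_zero]
    have := pi_pos
    positivity
  · have hpt : ∀ x, ‖F x + β * Complex.I * g x‖ ^ 2
        = l ^ 2 * ‖g x‖ ^ 2 - μ * (π ^ 2 / 4) * cos (x * π) := by
      intro x
      rw [hgn]
      have : F x + β * Complex.I * g x = G x * (((1 + β * a) * sin (x * (π / 2)) : ℝ)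
          + ((β * (cos (x * (π / 2)) * (π / 2)) : ℝ) : ℂ) * Complex.I) := by
        simp only [hF, hgdef]
        push_cast
        linear_combination (-G x * β * a * Complex.sin (x * (π / 2))) * Complex.I_sq
      rw [this, norm_mul, hGn, one_mul, ← Complex.normSq_eq_norm_sq, Complex.normSq_add_mul_I,
        show x * π = 2 * (x * (π / 2)) by ring, cos_two_mul']
      generalize cos (x * (π / 2)) = c
      generalize sin (x * (π / 2)) = s
      have e1 : 1 + β * a = μ * (π ^ 2 / 4) := by
        rw [ha]; field_simp; linear_combination 4 * h2 - 4 * h1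
      have e2 : l ^ 2 * a ^ 2 = β ^ 2 * (π ^ 2 / 4) := by
        rw [ha, h2]; field_simp
      have e3 : β ^ 2 = l ^ 2 - μ := by linarith
      rw [e1]
      rw [e3] at e2
      linear_combination (-s^2 ) * e2 + (π^2/4 * c^2) * e3 - s^2 * (π^2/4) * h2
    have ic : IntervalIntegrable (fun x => cos (x * π)) volume 0 1 :=
      Continuous.intervalIntegrable (by fun_prop) _ _
    have ig : IntervalIntegrable (fun x => ‖g x‖ ^ 2) volume 0 1 :=
      Continuous.intervalIntegrable (by fun_prop) _ _
    have hcz : ∫ x in (0:ℝ)..1, cos (x * π) = 0 := by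
      rw [intervalIntegral.integral_comp_mul_right _ pi_ne_zero]
      simp
    simp only [hFi, hpt]
    rw [intervalIntegral.integral_sub (ig.const_mul _) (ic.const_mul _),
      intervalIntegral.integral_const_mul, intervalIntegral.integral_const_mul, hcz]
    ring

theorem norm_volterra_add_imag_smul_id (V : Lp ℂ 2 m →L[ℂ] Lp ℂ 2 m)
    (hV : ∀ f : Lp ℂ 2 m, V f =ᵐ[m] fun x => ∫ t in Set.Ioc 0 x, f t ∂m) :
    ∀ β : ℝ,
      ‖V + ((β : ℂ) * Complex.I) • (1 : Lp ℂ 2 m →L[ℂ] Lp ℂ 2 m)‖ =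
        1 / π + Real.sqrt (β ^ 2 + 1 / π ^ 2) := by
  intro β
  set l : ℝ := 1 / π + Real.sqrt (β ^ 2 + 1 / π ^ 2) with hl
  have hp := pi_pos
  have hl0 : 0 < l := by positivity
  have hs : Real.sqrt (β ^ 2 + 1 / π ^ 2) ^ 2 = β ^ 2 + 1 / π ^ 2 := sq_sqrt (by positivity)
  set μ : ℝ := 2 * l / π with hμd
  have hμ : 0 < μ := by positivity
  have h1 : l ^ 2 = β ^ 2 + μ := by
    have : Real.sqrt (β ^ 2 + 1 / π ^ 2) = l - 1 / π := by rw [hl]; ring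
    rw [this] at hs
    rw [hμd]
    linear_combination hs
  have h2 : l ^ 2 = μ ^ 2 * (π ^ 2 / 4) := by
    rw [hμd]; field_simp; norm_num
  have key := key_norm V hV β
  set T := V + ((β : ℂ) * Complex.I) • (1 : Lp ℂ 2 m →L[ℂ] Lp ℂ 2 m)
  apply le_antisymm
  · apply T.opNorm_le_bound hl0.le
    have hd : DenseRange (BoundedContinuousFunction.toLp (E := ℂ) (p := 2) m ℂ) :=
      BoundedContinuousFunction.toLp_denseRange ℂ m ℂ (by norm_num)
    intro u
    refine hd.induction_on u (isClosed_le (by fun_prop) (by fun_prop)) ?_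
    intro g
    have hg := BoundedContinuousFunction.coeFn_toLp (p := 2) m ℂ g
    refine le_of_sq_le_sq ?_ (by positivity)
    rw [mul_pow, key _ _ hg, norm_sq_lp _ _ hg]
    exact ineq_cont g g.continuous β l μ hμ h1 h2
  · obtain ⟨g, hgc, hpos, heq⟩ := extremal β l μ hμ h1 h2
    have hmem : MemLp g 2 m := by
      obtain ⟨C, hC⟩ := isCompact_Icc.exists_bound_of_continuousOn
        (hgc.continuousOn (s := Set.Icc (0:ℝ) 1))
      exact MemLp.of_bound hgc.aestronglyMeasurable C
        ((ae_restrict_mem measurableSet_Icc).mono hC)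
    have hg := hmem.coeFn_toLp
    have e1 := norm_sq_lp _ _ hg
    have e2 := key _ _ hg
    rw [heq, ← e1, ← mul_pow] at e2
    have e3 := (sq_eq_sq₀ (norm_nonneg _) (by positivity)).1 e2
    have hn : 0 < ‖hmem.toLp g‖ := by
      rw [← e1] at hpos
      exact lt_of_le_of_ne (norm_nonneg _) fun h => by simp [← h] at hpos
    have := T.le_opNorm (hmem.toLp g)
    rw [e3] at this
    exact le_of_mul_le_mul_right this hn
end
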